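/- arXiv:1607.03832 — 3 statements merged into one kernel-verified Lean document; each statement's English description precedes it below -/
import Mathlib

section
/- Let λ ∈ ℝ∖{0} be fixed. For F, H ∈ L¹ ∩ L²(ℂⁿ × K), define the λ-twisted convolution (F ×_λ H)(z, k) = ∫_K ∫_{ℂⁿ} F(z − k s⁻¹ w, k s⁻¹) H(w, s) exp((iλ/2) Im(z · conj(k s⁻¹ w))) dw ds, where z · conj(u) = ∑_{j=1}^n z_j conj(u_j). Then F ×_λ H ∈ L¹(ℂⁿ × K) and W_σ^λ(F ×_λ H) = W_σ^λ(F) W_σ^λ(H) as operators on H²_σ. -/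
open MeasureTheory Complex

noncomputable section

/-- ℝⁿ with the Euclidean structure. -/
abbrev En (n : ℕ) := EuclideanSpace ℝ (Fin n)

/-- ℂⁿ, carrying the Lebesgue (product) measure. -/
abbrev Cn (n : ℕ) := Fin n → ℂ

/-- K = U(n), the group of n×n complex unitary matrices. -/
abbrev Kgp (n : ℕ) := Matrix.unitaryGroup (Fin n) ℂ

instance (n : ℕ) : MeasurableSpace (Kgp n) := borel _
instance (n : ℕ) : BorelSpace (Kgp n) := ⟨rfl⟩

/-- L²(ℝⁿ, ℂ). -/
abbrev HL2 (n : ℕ) := Lp ℂ 2 (volume : Measure (En n))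

/-- H²_σ = L²(ℝⁿ; H_σ). -/
abbrev H2 (n : ℕ) (V : Type) [NormedAddCommGroup V] := Lp V 2 (volume : Measure (En n))

/-- The action of k ∈ U(n) on ℂⁿ by matrix multiplication. -/
def kAct {n : ℕ} (k : Kgp n) (z : Cn n) : Cn n :=
  (k : Matrix (Fin n) (Fin n) ℂ).mulVec z

/-- The matrix coefficient `⟨π_λ(z,t)u, v⟩` of the Schrödinger representation:
`(π_λ(z,t)u)(ξ) = e^{iλt} e^{iλ(x·ξ + (1/2)x·y)} u(ξ+y)` with z = x + iy, and the inner
product `⟨u,v⟩ = ∫ u conj(v)`. -/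
def schroPair {n : ℕ} (lam : ℝ) (z : Cn n) (t : ℝ) (u v : En n → ℂ) : ℂ :=
  ∫ ξ : En n,
    Complex.exp (Complex.I * ((lam * t : ℝ) : ℂ)) *
      Complex.exp (Complex.I *
        ((lam * ∑ j, ((z j).re * ξ j + (1 / 2) * ((z j).re * (z j).im)) : ℝ) : ℂ)) *
      u (ξ + (show En n from WithLp.toLp 2 fun j => (z j).im)) * (starRingEnd ℂ) (v ξ)

/-- `IsMetaplectic lam M` : M is a strongly continuous unitary representation of K on
L²(ℝⁿ) intertwining π_λ(k·z, t) = M(k) π_λ(z,t) M(k)* (the intertwining relation is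
expressed weakly via the matrix coefficients of π_λ). -/
def IsMetaplectic {n : ℕ} (lam : ℝ) (M : Kgp n →* unitary (HL2 n →L[ℂ] HL2 n)) : Prop :=
  (∀ φ : HL2 n, Continuous fun k => (M k : HL2 n →L[ℂ] HL2 n) φ) ∧
  ∀ (z : Cn n) (t : ℝ) (k : Kgp n) (φ ψ : HL2 n),
    schroPair lam (kAct k z) t (⇑φ) (⇑ψ) =
      schroPair lam z t (⇑((star (M k) : HL2 n →L[ℂ] HL2 n) φ))
        (⇑((star (M k) : HL2 n →L[ℂ] HL2 n) ψ))

section Rho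

variable {n : ℕ} {V : Type} [NormedAddCommGroup V] [InnerProductSpace ℂ V] [CompleteSpace V]

/-- The operator μ(k) ⊗ 1 on L²(ℝⁿ; H_σ): application of μ(k) componentwise with
respect to a fixed orthonormal basis b of H_σ. -/
def muTensorOne (M : Kgp n →* unitary (HL2 n →L[ℂ] HL2 n)) {m : ℕ}
    (b : OrthonormalBasis (Fin m) ℂ V) (k : Kgp n) (f : H2 n V) : H2 n V :=
  ∑ i, ((ContinuousLinearMap.toSpanSingleton ℂ (b i)).compLpL 2 volume)
    ((M k : HL2 n →L[ℂ] HL2 n) (((innerSL ℂ (b i)).compLpL 2 volume) f))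

/-- The matrix coefficient `⟨ρ_σ^λ(z,t,k) f, g⟩` of the representation
ρ_σ^λ(z,t,k) = π_λ(z,t) μ(k) ⊗ σ(k) on H²_σ: first μ(k) componentwise (w.r.t. the
basis b), then σ(k) pointwise, then π_λ(z,t) componentwise; finally the L² inner
product ⟨u,v⟩ = ∫ ⟨u(ξ), v(ξ)⟩_{H_σ} dξ (linear in u, conjugate-linear in v). -/
def rhoPair (lam : ℝ) (M : Kgp n →* unitary (HL2 n →L[ℂ] HL2 n))
    (σr : Kgp n →* unitary (V →L[ℂ] V)) {m : ℕ} (b : OrthonormalBasis (Fin m) ℂ V)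
    (z : Cn n) (t : ℝ) (k : Kgp n) (f g : H2 n V) : ℂ :=
  ∫ ξ : En n,
    @inner ℂ _ _ (g ξ)
      ((Complex.exp (Complex.I * ((lam * t : ℝ) : ℂ)) *
        Complex.exp (Complex.I *
          ((lam * ∑ j, ((z j).re * ξ j + (1 / 2) * ((z j).re * (z j).im)) : ℝ) : ℂ))) •
        (σr k : V →L[ℂ] V)
          ((muTensorOne M b k f) (ξ + (show En n from WithLp.toLp 2 fun j => (z j).im))))

/-- `IsWeylMG`: W is the Weyl transform `W_σ^λ(F)` of `F ∈ L¹(ℂⁿ × K)`, determined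
weakly by `⟨W_σ^λ(F)φ, ψ⟩ = ∫_K ∫_{ℂⁿ} F(z,k) ⟨ρ_σ^λ(z,k)φ, ψ⟩ dz dk`. -/
def IsWeylMG (lam : ℝ) (M : Kgp n →* unitary (HL2 n →L[ℂ] HL2 n))
    (σr : Kgp n →* unitary (V →L[ℂ] V)) {m : ℕ} (b : OrthonormalBasis (Fin m) ℂ V)
    (μK : Measure (Kgp n)) (F : Cn n × Kgp n → ℂ) (W : H2 n V →L[ℂ] H2 n V) : Prop :=
  ∀ f g : H2 n V,
    (∫ ξ : En n, @inner ℂ _ _ (g ξ) ((W f) ξ)) =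
      ∫ k : Kgp n, (∫ z : Cn n, F (z, k) * rhoPair lam M σr b z 0 k f g) ∂μK

end Rho

/-- The λ-twisted convolution on ℂⁿ × K:
`(F ×_λ H)(z,k) = ∫_K ∫_{ℂⁿ} F(z − k s⁻¹ w, k s⁻¹) H(w,s)
exp((iλ/2) Im(z · conj(k s⁻¹ w))) dw ds`, where `z · conj(u) = ∑_j z_j conj(u_j)`. -/
def twConvMG {n : ℕ} (lam : ℝ) (μK : Measure (Kgp n)) (F H : Cn n × Kgp n → ℂ)
    (p : Cn n × Kgp n) : ℂ :=
  ∫ s : Kgp n, (∫ w : Cn n,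
    F (p.1 - kAct (p.2 * s⁻¹) w, p.2 * s⁻¹) * H (w, s) *
      Complex.exp (Complex.I *
        ((lam / 2 * (∑ j, p.1 j * (starRingEnd ℂ) (kAct (p.2 * s⁻¹) w j)).im : ℝ) : ℂ))) ∂μK

section helpers

instance kgp_sc (n : ℕ) : SecondCountableTopology (Kgp n) := by
  have : SecondCountableTopology (Matrix (Fin n) (Fin n) ℂ) :=
    inferInstanceAs (SecondCountableTopology (Fin n → Fin n → ℂ))
  exact TopologicalSpace.Subtype.secondCountableTopology _

instance kgp_metr (n : ℕ) : TopologicalSpace.MetrizableSpace (Kgp n) := by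
  have : TopologicalSpace.MetrizableSpace (Matrix (Fin n) (Fin n) ℂ) :=
    inferInstanceAs (TopologicalSpace.MetrizableSpace (Fin n → Fin n → ℂ))
  exact inferInstanceAs (TopologicalSpace.MetrizableSpace
    {x : Matrix (Fin n) (Fin n) ℂ // x ∈ Matrix.unitaryGroup (Fin n) ℂ})

lemma kgp_rinv {n : ℕ} (μK : Measure (Kgp n)) [μK.IsHaarMeasure] [IsProbabilityMeasure μK]
    (g : Kgp n) : MeasurePreserving (fun k : Kgp n => k * g) μK μK := by
  have hmeas : Measurable (fun k : Kgp n => k * g) := measurable_mul_const g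
  refine ⟨hmeas, ?_⟩
  have : IsProbabilityMeasure (Measure.map (fun k : Kgp n => k * g) μK) :=
    Measure.isProbabilityMeasure_map hmeas.aemeasurable
  have : (Measure.map (fun k : Kgp n => k * g) μK).IsMulLeftInvariant := by
    refine ⟨fun h => ?_⟩
    rw [Measure.map_map (measurable_const_mul h) hmeas]
    have : ((fun x => h * x) ∘ fun k : Kgp n => k * g) =
        (fun k : Kgp n => k * g) ∘ (fun x => h * x) := by
      ext1 k; simp [mul_assoc]
    rw [this, ← Measure.map_map hmeas (measurable_const_mul h), map_mul_left_eq_self]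
  have := measure_eq_div_smul (Measure.map (fun k : Kgp n => k * g) μK) μK
    (s := Set.univ) (by simp) (by simp)
  simpa using this

lemma continuous_kAct {n : ℕ} : Continuous fun p : Kgp n × Cn n => kAct p.1 p.2 := by
  unfold kAct
  exact Continuous.matrix_mulVec (continuous_subtype_val.comp continuous_fst) continuous_snd

lemma kAct_mul {n : ℕ} (k s : Kgp n) (z : Cn n) : kAct (k * s) z = kAct k (kAct s z) := by
  simp [kAct, Matrix.mulVec_mulVec]

/-- the group law -/
def gmul {n : ℕ} (p q : Cn n × Kgp n) : Cn n × Kgp n := (p.1 + kAct p.2 q.1, p.2 * q.2)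

/-- division in the group -/
def gdiv {n : ℕ} (p q : Cn n × Kgp n) : Cn n × Kgp n :=
  (p.1 - kAct (p.2 * q.2⁻¹) q.1, p.2 * q.2⁻¹)

lemma gmul_gdiv {n : ℕ} (p q : Cn n × Kgp n) : gmul (gdiv p q) q = p := by
  simp [gmul, gdiv]

lemma continuous_gmul {n : ℕ} :
    Continuous fun x : (Cn n × Kgp n) × (Cn n × Kgp n) => gmul x.1 x.2 := by
  unfold gmul
  refine Continuous.prodMk ?_ (by fun_prop)
  refine Continuous.add (by fun_prop) ?_
  exact continuous_kAct.comp (Continuous.prodMk (by fun_prop) (by fun_prop))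

lemma continuous_gdiv {n : ℕ} :
    Continuous fun x : (Cn n × Kgp n) × (Cn n × Kgp n) => gdiv x.1 x.2 := by
  unfold gdiv
  refine Continuous.prodMk ?_ (by fun_prop)
  refine Continuous.sub (by fun_prop) ?_
  exact continuous_kAct.comp (Continuous.prodMk (by fun_prop) (by fun_prop))

lemma mp_gdiv {n : ℕ} (μK : Measure (Kgp n)) [μK.IsHaarMeasure] [IsProbabilityMeasure μK]
    (q : Cn n × Kgp n) :
    MeasurePreserving (fun p => gdiv p q) ((volume : Measure (Cn n)).prod μK)
      ((volume : Measure (Cn n)).prod μK) := by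
  have h1 := MeasurePreserving.skew_product (μc := (volume : Measure (Cn n)))
    (μd := (volume : Measure (Cn n))) (kgp_rinv μK q.2⁻¹)
    (g := fun k z => z - kAct (k * q.2⁻¹) q.1) (by
      refine Continuous.measurable ?_
      refine Continuous.sub (by fun_prop) ?_
      exact continuous_kAct.comp (Continuous.prodMk (by fun_prop) (by fun_prop)))
    (Filter.Eventually.of_forall fun k => (measurePreserving_sub_right volume _).map_eq)
  exact Measure.measurePreserving_swap.comp (h1.comp Measure.measurePreserving_swap)

lemma mp_Phi {n : ℕ} (μK : Measure (Kgp n)) [μK.IsHaarMeasure] [IsProbabilityMeasure μK] :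
    MeasurePreserving (fun x : (Cn n × Kgp n) × (Cn n × Kgp n) => (gdiv x.1 x.2, x.2))
      (((volume : Measure (Cn n)).prod μK).prod ((volume : Measure (Cn n)).prod μK))
      (((volume : Measure (Cn n)).prod μK).prod ((volume : Measure (Cn n)).prod μK)) := by
  have h1 := MeasurePreserving.skew_product (MeasurePreserving.id ((volume : Measure (Cn n)).prod μK))
    (μc := ((volume : Measure (Cn n)).prod μK))
    (μd := ((volume : Measure (Cn n)).prod μK)) 
    (g := fun q p => gdiv p q) 
      ((continuous_gdiv.comp continuous_swap).measurable)
    (Filter.Eventually.of_forall fun q => (mp_gdiv μK q).map_eq)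
  exact Measure.measurePreserving_swap.comp (h1.comp Measure.measurePreserving_swap)

/-- the cocycle -/
def coc {n : ℕ} (lam : ℝ) (z u : Cn n) : ℂ :=
  Complex.exp (Complex.I * ((lam / 2 * (∑ j, z j * (starRingEnd ℂ) (u j)).im : ℝ) : ℂ))

lemma norm_coc {n : ℕ} (lam : ℝ) (z u : Cn n) : ‖coc lam z u‖ = 1 := by
  unfold coc; rw [mul_comm]; exact Complex.norm_exp_ofReal_mul_I _

lemma coc_sub {n : ℕ} (lam : ℝ) (z u : Cn n) : coc lam (z - u) u = coc lam z u := by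
  unfold coc
  congr 4
  simp only [Pi.sub_apply, sub_mul, Finset.sum_sub_distrib, Complex.mul_conj, Complex.sub_im,
    Complex.im_sum, Complex.ofReal_im]
  simp

lemma continuous_coc {n : ℕ} (lam : ℝ) : Continuous fun x : Cn n × Cn n => coc lam x.1 x.2 := by
  unfold coc; fun_prop


/-- the phase -/
def ph {n : ℕ} (lam : ℝ) (z : Cn n) (ξ : En n) : ℂ :=
  Complex.exp (Complex.I *
    ((lam * ∑ j, ((z j).re * ξ j + (1 / 2) * ((z j).re * (z j).im)) : ℝ) : ℂ))

/-- imaginary part -/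
def imv {n : ℕ} (z : Cn n) : En n := WithLp.toLp 2 fun j => (z j).im

lemma norm_ph {n : ℕ} (lam : ℝ) (z : Cn n) (ξ : En n) : ‖ph lam z ξ‖ = 1 := by
  unfold ph; rw [mul_comm]; exact Complex.norm_exp_ofReal_mul_I _

lemma continuous_imv {n : ℕ} : Continuous (imv : Cn n → En n) := by
  unfold imv; fun_prop

lemma continuous_ph {n : ℕ} (lam : ℝ) : Continuous fun x : Cn n × En n => ph lam x.1 x.2 := by
  unfold ph; fun_prop

lemma imv_add {n : ℕ} (z w : Cn n) : imv (z + w) = imv z + imv w := by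
  ext j; simp [imv]

lemma ph_mul {n : ℕ} (lam : ℝ) (z w : Cn n) (ξ : En n) :
    ph lam z ξ * ph lam w (ξ + imv z) = coc lam z w * ph lam (z + w) ξ := by
  unfold ph coc
  rw [← Complex.exp_add, ← Complex.exp_add, ← mul_add, ← mul_add, ← Complex.ofReal_add,
    ← Complex.ofReal_add]
  congr 3
  simp only [Complex.im_sum, Finset.mul_sum, ← Finset.sum_add_distrib]
  refine Finset.sum_congr rfl fun j _ => ?_
  simp [imv]
  ring

section ops
variable {n : ℕ} {V : Type} [NormedAddCommGroup V] [InnerProductSpace ℂ V]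

lemma mp_shift (z : Cn n) : MeasurePreserving (fun ξ : En n => ξ + imv z) volume volume :=
  measurePreserving_add_right volume _

lemma memLp_P (lam : ℝ) (z : Cn n) (f : H2 n V) :
    MemLp (fun ξ : En n => ph lam z ξ • f (ξ + imv z)) 2 volume := by
  have h1 : MemLp (fun ξ : En n => f (ξ + imv z)) 2 volume :=
    (Lp.memLp f).comp_measurePreserving (mp_shift z)
  refine MemLp.of_le h1 ?_ ?_
  · exact ((continuous_ph lam).comp (Continuous.prodMk continuous_const continuous_id)).aestronglyMeasurable.smul
      h1.1
  · exact Filter.Eventually.of_forall fun ξ => by simp [norm_smul, norm_ph]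

/-- the Schrodinger operator -/
def Pop (lam : ℝ) (z : Cn n) : H2 n V →L[ℂ] H2 n V :=
  LinearMap.mkContinuous
    { toFun := fun f => (memLp_P lam z f).toLp _
      map_add' := fun f g => by
        rw [← MemLp.toLp_add]
        refine MemLp.toLp_congr _ _ ?_
        filter_upwards [(mp_shift z).quasiMeasurePreserving.ae (Lp.coeFn_add f g)] with ξ h
        simp only [Pi.add_apply] at h ⊢
        rw [h, smul_add]
      map_smul' := fun c f => by
        rw [RingHom.id_apply, ← MemLp.toLp_const_smul]
        refine MemLp.toLp_congr _ _ ?_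
        filter_upwards [(mp_shift z).quasiMeasurePreserving.ae (Lp.coeFn_smul c f)] with ξ h
        simp [h, smul_smul, mul_comm] } 1 (fun f => by
      have h1 : MemLp (fun ξ : En n => f (ξ + imv z)) 2 volume :=
        (Lp.memLp f).comp_measurePreserving (mp_shift z)
      rw [one_mul]
      simp only [LinearMap.coe_mk, AddHom.coe_mk]
      rw [Lp.norm_toLp, Lp.norm_def]
      refine ENNReal.toReal_mono (Lp.eLpNorm_ne_top f) ?_
      rw [← eLpNorm_comp_measurePreserving (Lp.aestronglyMeasurable f) (mp_shift z)]
      refine eLpNorm_mono fun ξ => ?_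
      simp [norm_smul, norm_ph])

lemma Pop_coe (lam : ℝ) (z : Cn n) (f : H2 n V) :
    Pop lam z f =ᵐ[volume] fun ξ : En n => ph lam z ξ • f (ξ + imv z) :=
  MemLp.coeFn_toLp (memLp_P lam z f)

lemma Pop_norm (lam : ℝ) (z : Cn n) (f : H2 n V) : ‖Pop lam z f‖ ≤ ‖f‖ := by
  have := ContinuousLinearMap.le_of_opNorm_le (Pop (V := V) lam z)
    (LinearMap.mkContinuous_norm_le _ zero_le_one _) f
  simpa using this

lemma Pop_mul (lam : ℝ) (z w : Cn n) (f : H2 n V) :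
    Pop lam z (Pop lam w f) = coc lam z w • Pop lam (z + w) f := by
  apply Lp.ext
  filter_upwards [Pop_coe lam z (Pop lam w f), (mp_shift z).quasiMeasurePreserving.ae (Pop_coe lam w f),
    Pop_coe lam (z + w) f, Lp.coeFn_smul (coc lam z w) (Pop lam (z + w) f)] with ξ h1 h2 h3 h4
  rw [h1, h2, h4, Pi.smul_apply, h3, smul_smul, smul_smul, ph_mul, imv_add, add_assoc]

lemma inner_Pop_meas (lam : ℝ) (f g : H2 n V) :
    StronglyMeasurable fun z : Cn n => inner ℂ g (Pop lam z f) := by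
  have : (fun z : Cn n => inner ℂ g (Pop lam z f)) =
      fun z : Cn n => ∫ ξ : En n, inner ℂ (g ξ) (ph lam z ξ • f (ξ + imv z)) := by
    ext z
    rw [L2.inner_def]
    refine integral_congr_ae ?_
    filter_upwards [Pop_coe lam z f] with ξ h
    rw [h]
  rw [this]
  refine StronglyMeasurable.integral_prod_right (f := fun (z : Cn n) (ξ : En n) =>
    inner ℂ (g ξ) (ph lam z ξ • f (ξ + imv z))) ?_
  refine StronglyMeasurable.inner ?_ (StronglyMeasurable.smul ?_ ?_)
  · exact (Lp.stronglyMeasurable g).comp_measurable measurable_snd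
  · exact (continuous_ph lam).stronglyMeasurable
  · refine (Lp.stronglyMeasurable f).comp_measurable ?_
    exact (continuous_snd.add (continuous_imv.comp continuous_fst)).measurable

lemma schroPair_eq (lam : ℝ) (z : Cn n) (φ ψ : HL2 n) :
    schroPair lam z 0 φ ψ = inner ℂ ψ (Pop lam z φ) := by
  rw [L2.inner_def]
  refine integral_congr_ae ?_
  filter_upwards [Pop_coe lam z φ] with ξ h
  rw [h]
  simp only [mul_zero, Complex.ofReal_zero, Complex.exp_zero, one_mul, RCLike.inner_apply,
    smul_eq_mul]
  rfl

set_option maxHeartbeats 1000000 in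
lemma Pop_M {lam : ℝ} {M : Kgp n →* unitary (HL2 n →L[ℂ] HL2 n)} (hM : IsMetaplectic lam M)
    (k : Kgp n) (z : Cn n) (φ : HL2 n) :
    (M k : HL2 n →L[ℂ] HL2 n) (Pop lam z φ) = 
      Pop lam (kAct k z) ((M k : HL2 n →L[ℂ] HL2 n) φ) := by
  refine ext_inner_left ℂ fun ψ => ?_
  have h := hM.2 z 0 k ((M k : HL2 n →L[ℂ] HL2 n) φ) ψ
  rw [schroPair_eq, schroPair_eq] at h
  rw [h]
  have h2 : (star (M k : HL2 n →L[ℂ] HL2 n)) ((M k : HL2 n →L[ℂ] HL2 n) φ) = φ := by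
    have h3 : star (M k : HL2 n →L[ℂ] HL2 n) * (M k : HL2 n →L[ℂ] HL2 n) = 1 :=
      Unitary.coe_star_mul_self (M k)
    exact DFunLike.congr_fun h3 φ
  rw [h2, ContinuousLinearMap.star_eq_adjoint, ContinuousLinearMap.adjoint_inner_left]

/-- elementary tensors -/
def Jt (v : V) : HL2 n →L[ℂ] H2 n V :=
  (ContinuousLinearMap.toSpanSingleton ℂ v).compLpL 2 volume

lemma Jt_coe (v : V) (φ : HL2 n) : Jt v φ =ᵐ[volume] fun ξ : En n => φ ξ • v := by
  filter_upwards [ContinuousLinearMap.coeFn_compLpL (p := 2) (μ := (volume : Measure (En n))) (ContinuousLinearMap.toSpanSingleton ℂ v) φ] with ξ h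
  unfold Jt
  rw [h]; simp

lemma Jt_add (v w : V) : (Jt (v + w) : HL2 n →L[ℂ] H2 n V) = Jt v + Jt w := by
  unfold Jt
  rw [← ContinuousLinearMap.add_compLpL]
  congr 1
  ext; simp

lemma Jt_smul (c : ℂ) (v : V) : (Jt (c • v) : HL2 n →L[ℂ] H2 n V) = c • Jt v := by
  unfold Jt
  rw [← ContinuousLinearMap.smul_compLpL]
  congr 1
  ext; simp

/-- linear version -/
def JtL : V →ₗ[ℂ] HL2 n →L[ℂ] H2 n V where
  toFun := Jt
  map_add' := Jt_add
  map_smul' := Jt_smul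

lemma Jt_expand {m : ℕ} (b : OrthonormalBasis (Fin m) ℂ V) (v : V) :
    (Jt v : HL2 n →L[ℂ] H2 n V) = ∑ i, inner ℂ (b i) v • Jt (b i) := by
  have : (JtL v : HL2 n →L[ℂ] H2 n V) = JtL (∑ i, inner ℂ (b i) v • b i) := by
    rw [b.sum_repr' v]
  rw [map_sum] at this
  simpa [JtL, Jt_smul] using this

/-- components -/
def cmpt (v : V) : H2 n V →L[ℂ] HL2 n := (innerSL ℂ v).compLpL 2 volume

lemma cmpt_Jt (u v : V) (φ : HL2 n) : cmpt u (Jt v φ) = inner ℂ u v • φ := by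
  apply Lp.ext
  filter_upwards [ContinuousLinearMap.coeFn_compLpL (p := 2) (μ := (volume : Measure (En n))) 
    (innerSL ℂ u) (Jt v φ), Jt_coe v φ, Lp.coeFn_smul (inner ℂ u v) φ] with ξ h1 h2 h3
  unfold cmpt
  rw [h1, h2, h3]
  simp [mul_comm]

lemma coeFn_fsum {ι : Type} (s : Finset ι) (F : ι → H2 n V) :
    ((∑ i ∈ s, F i : H2 n V) : En n → V) =ᵐ[volume] fun ξ => ∑ i ∈ s, F i ξ := by
  classical
  induction s using Finset.induction_on with
  | empty =>
    filter_upwards [Lp.coeFn_zero V 2 (volume : Measure (En n))] with ξ h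
    simp
  | insert a s ha ih =>
    rw [Finset.sum_insert ha]
    filter_upwards [ih, Lp.coeFn_add (F a) (∑ i ∈ s, F i)] with ξ h1 h2
    rw [h2, Finset.sum_insert ha, Pi.add_apply, h1]

lemma cmpt_expand {m : ℕ} (b : OrthonormalBasis (Fin m) ℂ V) (f : H2 n V) :
    f = ∑ i, Jt (b i) (cmpt (b i) f) := by
  apply Lp.ext
  have h1 : ∀ᵐ ξ : En n, ∀ i, Jt (b i) (cmpt (b i) f) ξ = inner ℂ (b i) (f ξ) • b i := by
    rw [ae_all_iff]
    intro i
    filter_upwards [Jt_coe (b i) (cmpt (b i) f), ContinuousLinearMap.coeFn_compLpL (p := 2) (μ := (volume : Measure (En n))) 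
      (innerSL ℂ (b i)) f] with ξ h1 h2
    rw [h1]
    unfold cmpt
    rw [h2]; simp
  filter_upwards [h1, coeFn_fsum Finset.univ (fun i => Jt (b i) (cmpt (b i) f))] with ξ h1 h2
  rw [h2]
  simp [h1, b.sum_repr' (f ξ)]

lemma ext_Jt {m : ℕ} (b : OrthonormalBasis (Fin m) ℂ V) {A B : H2 n V →L[ℂ] H2 n V}
    (h : ∀ v φ, A (Jt v φ) = B (Jt v φ)) : A = B := by
  ext1 f
  rw [cmpt_expand b f, map_sum, map_sum]
  exact Finset.sum_congr rfl fun i _ => h _ _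

lemma Pop_Jt (lam : ℝ) (z : Cn n) (v : V) (φ : HL2 n) :
    Pop lam z (Jt v φ) = Jt v (Pop lam z φ) := by
  apply Lp.ext
  filter_upwards [Pop_coe lam z (Jt v φ), (mp_shift z).quasiMeasurePreserving.ae (Jt_coe v φ),
    Jt_coe v (Pop lam z φ), Pop_coe lam z φ] with ξ h1 h2 h3 h4
  rw [h1, h2, h3, h4, smul_smul, smul_eq_mul]

lemma A_Jt (A : V →L[ℂ] V) (v : V) (φ : HL2 n) :
    A.compLpL 2 volume (Jt v φ) = Jt (A v) φ := by
  apply Lp.ext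
  filter_upwards [ContinuousLinearMap.coeFn_compLpL (p := 2) (μ := (volume : Measure (En n))) 
    A (Jt v φ), Jt_coe v φ, Jt_coe (A v) φ] with ξ h1 h2 h3
  rw [h1, h2, h3, map_smul]

set_option maxHeartbeats 1000000

section rops
variable [CompleteSpace V] {m : ℕ}

/-- μ(k) ⊗ σ(k) -/
def Sop (M : Kgp n →* unitary (HL2 n →L[ℂ] HL2 n)) (σr : Kgp n →* unitary (V →L[ℂ] V))
    (b : OrthonormalBasis (Fin m) ℂ V) (k : Kgp n) : H2 n V →L[ℂ] H2 n V :=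
  ((σr k : V →L[ℂ] V).compLpL 2 volume).comp
    (∑ i, (Jt (b i)).comp ((M k : HL2 n →L[ℂ] HL2 n).comp (cmpt (b i))))

/-- the representation -/
def Rop (lam : ℝ) (M : Kgp n →* unitary (HL2 n →L[ℂ] HL2 n)) (σr : Kgp n →* unitary (V →L[ℂ] V))
    (b : OrthonormalBasis (Fin m) ℂ V) (p : Cn n × Kgp n) : H2 n V →L[ℂ] H2 n V :=
  (Pop lam p.1).comp (Sop M σr b p.2)

variable (lam : ℝ) (M : Kgp n →* unitary (HL2 n →L[ℂ] HL2 n)) (σr : Kgp n →* unitary (V →L[ℂ] V))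
    (b : OrthonormalBasis (Fin m) ℂ V)

lemma Sop_apply (k : Kgp n) (f : H2 n V) :
    Sop M σr b k f = (σr k : V →L[ℂ] V).compLpL 2 volume (muTensorOne M b k f) := by
  unfold Sop muTensorOne Jt cmpt
  rw [ContinuousLinearMap.comp_apply, _root_.sum_apply]
  rfl

lemma Sop_apply' (k : Kgp n) (f : H2 n V) :
    Sop M σr b k f = ∑ i, Jt ((σr k : V →L[ℂ] V) (b i))
      ((M k : HL2 n →L[ℂ] HL2 n) (cmpt (b i) f)) := by
  unfold Sop
  rw [ContinuousLinearMap.comp_apply, _root_.sum_apply]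
  refine (map_sum ((σr k : V →L[ℂ] V).compLpL 2 (volume : Measure (En n))) _ _).trans ?_
  exact Finset.sum_congr rfl fun i _ => A_Jt _ _ _

lemma Sop_Jt (k : Kgp n) (v : V) (φ : HL2 n) :
    Sop M σr b k (Jt v φ) = Jt ((σr k : V →L[ℂ] V) v) ((M k : HL2 n →L[ℂ] HL2 n) φ) := by
  rw [← A_Jt]
  unfold Sop
  rw [ContinuousLinearMap.comp_apply, _root_.sum_apply]
  congr 1
  simp only [ContinuousLinearMap.comp_apply, cmpt_Jt, ContinuousLinearMap.map_smul]
  rw [Jt_expand b v, _root_.sum_apply]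
  rfl

lemma rhoPair_eq (z : Cn n) (k : Kgp n) (f g : H2 n V) :
    rhoPair lam M σr b z 0 k f g = inner ℂ g (Rop lam M σr b (z, k) f) := by
  rw [L2.inner_def]
  refine integral_congr_ae ?_
  filter_upwards [Pop_coe lam z (Sop M σr b k f), (mp_shift z).quasiMeasurePreserving.ae
    (ContinuousLinearMap.coeFn_compLpL (p := 2) (μ := (volume : Measure (En n)))
      (σr k : V →L[ℂ] V) (muTensorOne M b k f))] with ξ h1 h2
  unfold Rop
  rw [ContinuousLinearMap.comp_apply, h1, Sop_apply, h2]
  simp only [mul_zero, Complex.ofReal_zero, Complex.exp_zero, one_mul]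
  rfl

lemma norm_Jt_le (v : V) (φ : HL2 n) : ‖Jt v φ‖ ≤ ‖v‖ * ‖φ‖ := by
  refine (ContinuousLinearMap.le_opNorm _ _).trans ?_
  gcongr
  refine (ContinuousLinearMap.norm_compLpL_le _).trans ?_
  simp

lemma norm_cmpt_le (v : V) (f : H2 n V) : ‖cmpt v f‖ ≤ ‖v‖ * ‖f‖ := by
  refine (ContinuousLinearMap.le_opNorm _ _).trans ?_
  gcongr
  refine (ContinuousLinearMap.norm_compLpL_le _).trans ?_
  simp

lemma Rop_norm (p : Cn n × Kgp n) (f : H2 n V) : ‖Rop lam M σr b p f‖ ≤ m * ‖f‖ := by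
  unfold Rop
  rw [ContinuousLinearMap.comp_apply]
  refine (Pop_norm _ _ _).trans ?_
  rw [Sop_apply']
  have hc : ∑ _i : Fin m, ‖f‖ = m * ‖f‖ := by simp
  rw [← hc]
  refine norm_sum_le_of_le _ fun i _ => ?_
  refine (norm_Jt_le _ _).trans ?_
  rw [Unitary.norm_map, Unitary.norm_map, b.norm_eq_one, one_mul]
  refine (norm_cmpt_le _ _).trans ?_
  rw [b.norm_eq_one, one_mul]

variable {lam M}

lemma Rop_mul (hM : IsMetaplectic lam M) (p q : Cn n × Kgp n) (f : H2 n V) :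
    Rop lam M σr b p (Rop lam M σr b q f) =
      coc lam p.1 (kAct p.2 q.1) • Rop lam M σr b (gmul p q) f := by
  have : (Rop lam M σr b p).comp (Rop lam M σr b q) =
      coc lam p.1 (kAct p.2 q.1) • Rop lam M σr b (gmul p q) := by
    refine ext_Jt b fun v φ => ?_
    simp only [Rop, ContinuousLinearMap.comp_apply, _root_.smul_apply, Sop_Jt, Pop_Jt]
    rw [Pop_M hM, Pop_mul, ContinuousLinearMap.map_smul]
    simp only [gmul, map_mul]
    rfl
  exact DFunLike.congr_fun this f

lemma Sop_cont (hM : IsMetaplectic lam M)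
    (hσcont : ∀ v : V, Continuous fun k => (σr k : V →L[ℂ] V) v) (f : H2 n V) :
    Continuous fun k => Sop M σr b k f := by
  simp only [Sop_apply']
  refine continuous_finsetSum _ fun i _ => ?_
  have : ∀ k : Kgp n, Jt ((σr k : V →L[ℂ] V) (b i)) ((M k : HL2 n →L[ℂ] HL2 n) (cmpt (b i) f)) =
      ∑ j, inner ℂ (b j) ((σr k : V →L[ℂ] V) (b i)) • Jt (b j)
        ((M k : HL2 n →L[ℂ] HL2 n) (cmpt (b i) f)) := by
    intro k
    rw [Jt_expand b ((σr k : V →L[ℂ] V) (b i)), _root_.sum_apply]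
    rfl
  simp only [this]
  refine continuous_finsetSum _ fun j _ => ?_
  have c1 : Continuous fun k => inner ℂ (b j) ((σr k : V →L[ℂ] V) (b i)) :=
    continuous_const.inner (hσcont _)
  have c2 : Continuous fun k => (Jt (b j) : HL2 n →L[ℂ] H2 n V)
        ((M k : HL2 n →L[ℂ] HL2 n) (cmpt (b i) f)) :=
    (ContinuousLinearMap.continuous _).comp (hM.1 _)
  exact c1.smul c2

lemma Rop_apply (p : Cn n × Kgp n) (f : H2 n V) :
    Rop lam M σr b p f = Pop lam p.1 (Sop M σr b p.2 f) := rfl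

attribute [irreducible] Rop Sop
attribute [local irreducible] Pop Jt cmpt coc

lemma cont_coc_comp {X : Type} [TopologicalSpace X] (lam : ℝ) {f g : X → Cn n}
    (hf : Continuous f) (hg : Continuous g) : Continuous fun x => coc lam (f x) (g x) :=
  (continuous_coc lam).comp (hf.prodMk hg)

lemma cont_kAct_comp {X : Type} [TopologicalSpace X] {f : X → Kgp n} {g : X → Cn n}
    (hf : Continuous f) (hg : Continuous g) : Continuous fun x => kAct (f x) (g x) :=
  continuous_kAct.comp (hf.prodMk hg)

lemma cont_coc1 (lam : ℝ) : Continuous fun x : (Cn n × Kgp n) × (Cn n × Kgp n) =>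
    coc lam x.1.1 (kAct (x.1.2 * x.2.2⁻¹) x.2.1) :=
  cont_coc_comp lam (continuous_fst.comp continuous_fst)
    (cont_kAct_comp ((continuous_snd.comp continuous_fst).mul
      (continuous_snd.comp continuous_snd).inv) (continuous_fst.comp continuous_snd))

lemma cont_coc2 (lam : ℝ) : Continuous fun x : (Cn n × Kgp n) × (Cn n × Kgp n) =>
    coc lam x.1.1 (kAct x.1.2 x.2.1) :=
  cont_coc_comp lam (continuous_fst.comp continuous_fst)
    (cont_kAct_comp (continuous_snd.comp continuous_fst) (continuous_fst.comp continuous_snd))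

lemma Rop_meas (hM : IsMetaplectic lam M)
    (hσcont : ∀ v : V, Continuous fun k => (σr k : V →L[ℂ] V) v) (f g : H2 n V) :
    StronglyMeasurable fun p => inner ℂ g (Rop lam M σr b p f) := by
  let u : Kgp n → Cn n → ℂ := fun k z => inner ℂ g (Pop lam z (Sop M σr b k f))
  have h1 : ∀ z, Continuous fun k => u k z := by
    intro z
    have c1 : Continuous fun k => Pop lam z (Sop M σr b k f) :=
      (ContinuousLinearMap.continuous (Pop lam z)).comp (Sop_cont σr b hM hσcont f)
    exact continuous_const.inner c1
  have h2 : ∀ k, StronglyMeasurable (u k) := fun k => inner_Pop_meas lam (Sop M σr b k f) g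
  have h3 := stronglyMeasurable_uncurry_of_continuous_of_stronglyMeasurable h1 h2
  have h4 : (fun p => inner ℂ g (Rop lam M σr b p f)) = Function.uncurry u ∘ Prod.swap := by
    funext p
    rw [Rop_apply]
    rfl
  rw [h4]
  exact h3.comp_measurable measurable_swap

lemma Rop_bdd (f g : H2 n V) (p : Cn n × Kgp n) :
    ‖inner ℂ g (Rop lam M σr b p f)‖ ≤ ‖g‖ * (m * ‖f‖) :=
  (norm_inner_le_norm _ _).trans (by gcongr; exact Rop_norm _ _ _ _ _ _)

lemma weyl_eq (hM : IsMetaplectic lam M)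
    (hσcont : ∀ v : V, Continuous fun k => (σr k : V →L[ℂ] V) v)
    (μK : Measure (Kgp n)) [IsProbabilityMeasure μK]
    {F : Cn n × Kgp n → ℂ} (hF : Integrable F ((volume : Measure (Cn n)).prod μK))
    {W : H2 n V →L[ℂ] H2 n V} (hW : IsWeylMG lam M σr b μK F W) (f g : H2 n V) :
    inner ℂ g (W f) = ∫ p, F p * inner ℂ g (Rop lam M σr b p f)
      ∂((volume : Measure (Cn n)).prod μK) := by
  rw [L2.inner_def, hW f g, integral_prod_symm]
  · simp only [rhoPair_eq]
  · exact hF.mul_bdd (c := ‖g‖ * (m * ‖f‖)) (Rop_meas σr b hM hσcont f g).aestronglyMeasurable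
      (Filter.Eventually.of_forall fun p => Rop_bdd σr b f g p)

/-- integrand of the twisted convolution -/
def Psi (lam : ℝ) (F H : Cn n × Kgp n → ℂ) (x : (Cn n × Kgp n) × (Cn n × Kgp n)) : ℂ :=
  F (gdiv x.1 x.2) * H x.2 * coc lam x.1.1 (kAct (x.1.2 * x.2.2⁻¹) x.2.1)

end rops

lemma Psi_int (lam : ℝ) (μK : Measure (Kgp n)) [μK.IsHaarMeasure] [IsProbabilityMeasure μK]
    {F H : Cn n × Kgp n → ℂ} (hF : Integrable F ((volume : Measure (Cn n)).prod μK))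
    (hH : Integrable H ((volume : Measure (Cn n)).prod μK)) :
    Integrable (Psi lam F H) (((volume : Measure (Cn n)).prod μK).prod
      ((volume : Measure (Cn n)).prod μK)) := by
  have h1 := (mp_Phi μK).integrable_comp_of_integrable (hF.mul_prod hH)
  have h2 : Psi lam F H = fun x => ((fun z : (Cn n × Kgp n) × (Cn n × Kgp n) => F z.1 * H z.2) ∘
      fun x => (gdiv x.1 x.2, x.2)) x * coc lam x.1.1 (kAct (x.1.2 * x.2.2⁻¹) x.2.1) := rfl
  rw [h2]
  refine h1.mul_bdd (c := 1) ?_ (Filter.Eventually.of_forall fun x => (norm_coc _ _ _).le)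
  exact (cont_coc1 lam).aestronglyMeasurable

lemma tw_ae (lam : ℝ) (μK : Measure (Kgp n)) [μK.IsHaarMeasure] [IsProbabilityMeasure μK]
    {F H : Cn n × Kgp n → ℂ} (hF : Integrable F ((volume : Measure (Cn n)).prod μK))
    (hH : Integrable H ((volume : Measure (Cn n)).prod μK)) :
    twConvMG lam μK F H =ᵐ[(volume : Measure (Cn n)).prod μK] fun p =>
      ∫ q, Psi lam F H (p, q) ∂((volume : Measure (Cn n)).prod μK) := by
  filter_upwards [(Psi_int lam μK hF hH).prod_right_ae] with p hp
  rw [integral_prod_symm _ hp]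
  rfl

lemma weyl_main [CompleteSpace V] {m : ℕ} {lam : ℝ} {M : Kgp n →* unitary (HL2 n →L[ℂ] HL2 n)}
    (σr : Kgp n →* unitary (V →L[ℂ] V)) (b : OrthonormalBasis (Fin m) ℂ V)
    (hM : IsMetaplectic lam M)
    (hσcont : ∀ v : V, Continuous fun k => (σr k : V →L[ℂ] V) v)
    (μK : Measure (Kgp n)) [μK.IsHaarMeasure] [IsProbabilityMeasure μK]
    {F H : Cn n × Kgp n → ℂ} (hF : Integrable F ((volume : Measure (Cn n)).prod μK))
    (hH : Integrable H ((volume : Measure (Cn n)).prod μK))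
    {W₁ W₂ W₃ : H2 n V →L[ℂ] H2 n V}
    (hI : Integrable (twConvMG lam μK F H) ((volume : Measure (Cn n)).prod μK))
    (h₁ : IsWeylMG lam M σr b μK (twConvMG lam μK F H) W₁)
    (h₂ : IsWeylMG lam M σr b μK F W₂) (h₃ : IsWeylMG lam M σr b μK H W₃) :
    W₁ = W₂.comp W₃ := by
  ext1 f
  refine ext_inner_left ℂ fun g => ?_
  obtain ⟨ν, hν⟩ : ∃ ν, ν = (volume : Measure (Cn n)).prod μK := ⟨_, rfl⟩
  have : SFinite ν := by rw [hν]; infer_instance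
  have hw3 := fun g => weyl_eq σr b hM hσcont μK hH h₃ f g
  have hw2 := fun f => weyl_eq σr b hM hσcont μK hF h₂ f g
  have hw1 := weyl_eq σr b hM hσcont μK hI h₁ f g
  have hPi := Psi_int lam μK hF hH
  have htw := tw_ae lam μK hF hH
  have hmp := mp_Phi μK (n := n)
  rw [← hν] at hF hH hI hw1 hPi htw hmp
  simp only [← hν] at hw2 hw3
  obtain ⟨r, hr⟩ : ∃ r : Cn n × Kgp n → ℂ, r = fun p => inner ℂ g (Rop lam M σr b p f) := ⟨_, rfl⟩
  have hrm : StronglyMeasurable r := hr ▸ Rop_meas σr b hM hσcont f g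
  have hrb : ∀ p, ‖r p‖ ≤ ‖g‖ * (m * ‖f‖) := hr ▸ Rop_bdd σr b f g
  -- the product integrand
  obtain ⟨G, hG⟩ : ∃ G : (Cn n × Kgp n) × (Cn n × Kgp n) → ℂ, G = fun x =>
    F x.1 * H x.2 * (coc lam x.1.1 (kAct x.1.2 x.2.1) * r (gmul x.1 x.2)) := ⟨_, rfl⟩
  have hGint : Integrable G (ν.prod ν) := by
    rw [hG]
    refine (hF.mul_prod hH).mul_bdd (c := ‖g‖ * (m * ‖f‖)) ?_ (Filter.Eventually.of_forall fun x => ?_)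
    · refine AEStronglyMeasurable.mul ?_ ?_
      · exact (cont_coc2 lam).aestronglyMeasurable
      · exact (hrm.comp_measurable continuous_gmul.measurable).aestronglyMeasurable
    · rw [norm_mul, norm_coc, one_mul]; exact hrb _
  have hL : inner ℂ g (W₁ f) = ∫ x, G x ∂(ν.prod ν) := by
    rw [hw1]
    have e1 : ∫ p, twConvMG lam μK F H p * inner ℂ g (Rop lam M σr b p f) ∂ν =
        ∫ p, ∫ q, Psi lam F H (p, q) * r p ∂ν ∂ν := by
      refine integral_congr_ae ?_
      filter_upwards [htw] with p hp
      rw [hp, integral_mul_const, hr]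
    have e2 : Integrable (fun x => Psi lam F H x * r x.1) (ν.prod ν) :=
      hPi.mul_bdd (c := ‖g‖ * (m * ‖f‖))
        (hrm.comp_measurable measurable_fst).aestronglyMeasurable
        (Filter.Eventually.of_forall fun x => hrb _)
    rw [e1, ← integral_prod (fun x => Psi lam F H x * r x.1) e2]
    have e3 : ∫ x, G x ∂(ν.prod ν) = ∫ x, G (gdiv x.1 x.2, x.2) ∂(ν.prod ν) := by
      conv_lhs => rw [← hmp.map_eq]
      rw [integral_map hmp.aemeasurable]
      rw [hmp.map_eq]; exact hGint.aestronglyMeasurable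
    rw [e3]
    refine integral_congr_ae (Filter.Eventually.of_forall fun x => ?_)
    simp only [hG, gmul_gdiv, Psi]
    have : coc lam (gdiv x.1 x.2).1 (kAct (gdiv x.1 x.2).2 x.2.1) =
        coc lam x.1.1 (kAct (x.1.2 * x.2.2⁻¹) x.2.1) := coc_sub _ _ _
    rw [this]; ring
  have hR : inner ℂ g ((W₂.comp W₃) f) = ∫ x, G x ∂(ν.prod ν) := by
    rw [ContinuousLinearMap.comp_apply, hw2, integral_prod _ hGint]
    refine integral_congr_ae (Filter.Eventually.of_forall fun p => ?_)
    simp only [hG, hr]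
    rw [← ContinuousLinearMap.adjoint_inner_left, hw3, ← integral_const_mul]
    refine integral_congr_ae (Filter.Eventually.of_forall fun q => ?_)
    simp only []
    rw [ContinuousLinearMap.adjoint_inner_left, Rop_mul σr b hM, inner_smul_right]
    ring
  rw [hL, hR]

end ops
end helpers

/-- Fix λ ≠ 0. For F, H ∈ L¹ ∩ L²(ℂⁿ × K), the λ-twisted convolution
F ×_λ H lies in L¹(ℂⁿ × K) and W_σ^λ(F ×_λ H) = W_σ^λ(F) W_σ^λ(H) on H²_σ. -/
theorem stmt1 {n : ℕ} (lam : ℝ) (hlam : lam ≠ 0)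
    (μK : Measure (Kgp n)) [μK.IsHaarMeasure] [IsProbabilityMeasure μK]
    (M : Kgp n →* unitary (HL2 n →L[ℂ] HL2 n)) (hM : IsMetaplectic lam M)
    {V : Type} [NormedAddCommGroup V] [InnerProductSpace ℂ V] [FiniteDimensional ℂ V]
    (σr : Kgp n →* unitary (V →L[ℂ] V))
    (hσcont : ∀ v : V, Continuous fun k => (σr k : V →L[ℂ] V) v)
    {m : ℕ} (b : OrthonormalBasis (Fin m) ℂ V)
    (F H : Cn n × Kgp n → ℂ)
    (hFL1 : Integrable F (((volume : Measure (Cn n)).prod μK)))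
    (hFL2 : MemLp F 2 (((volume : Measure (Cn n)).prod μK)))
    (hHL1 : Integrable H (((volume : Measure (Cn n)).prod μK)))
    (hHL2 : MemLp H 2 (((volume : Measure (Cn n)).prod μK))) :
    Integrable (twConvMG lam μK F H) (((volume : Measure (Cn n)).prod μK)) ∧
    ∀ (W₁ W₂ W₃ : H2 n V →L[ℂ] H2 n V),
      IsWeylMG lam M σr b μK (twConvMG lam μK F H) W₁ →
      IsWeylMG lam M σr b μK F W₂ →
      IsWeylMG lam M σr b μK H W₃ →
      W₁ = W₂.comp W₃ := by
  have hI : Integrable (twConvMG lam μK F H) (((volume : Measure (Cn n)).prod μK)) :=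
    ((Psi_int lam μK hFL1 hHL1).integral_prod_left).congr (tw_ae lam μK hFL1 hHL1).symm
  exact ⟨hI, fun W₁ W₂ W₃ h₁ h₂ h₃ => weyl_main σr b hM hσcont μK hFL1 hHL1 hI h₁ h₂ h₃⟩
end
end

section
/- Let r > 0, let b_1, …, b_N ∈ ℂ∖{0}, and let χ_1, …, χ_N and φ_1, …, φ_N be functions in L²(ℝⁿ) such that the family {χ_1, …, χ_N} is linearly independent and the family {φ_1, …, φ_N} is linearly independent. Define, for y ∈ ℝⁿ, K_y(ξ) = ∑_{j=1}^N b_j χ_j(ξ + y) conj(φ_j(ξ)). If for every y ∈ ℝⁿ with |y| ≥ r one has K_y(ξ) = 0 for almost every ξ ∈ ℝⁿ, then each χ_j and each φ_j vanishes almost everywhere outside some compact subset of ℝⁿ. -/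
open MeasureTheory Complex

noncomputable section


lemma key_aux {n N : ℕ} (r : ℝ) (F X : Fin N → (EuclideanSpace ℝ (Fin n) → ℂ))
    (hind : ∀ v : Fin N → ℂ, (∀ᵐ ξ : EuclideanSpace ℝ (Fin n), ∑ j, v j * F j ξ = 0) → v = 0)
    (hp : ∀ᵐ η : EuclideanSpace ℝ (Fin n), ∀ᵐ ξ : EuclideanSpace ℝ (Fin n),
      r ≤ ‖η - ξ‖ → ∑ j, X j η * F j ξ = 0) :
    ∀ j, ∃ C : Set (EuclideanSpace ℝ (Fin n)), IsCompact C ∧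
      ∀ᵐ ξ : EuclideanSpace ℝ (Fin n), ξ ∉ C → X j ξ = 0 := by
  let V : ℕ → Submodule ℂ (Fin N → ℂ) := fun m =>
    { carrier := {v | ∀ᵐ ξ : EuclideanSpace ℝ (Fin n), ‖ξ‖ ≤ m → ∑ j, v j * F j ξ = 0}
      add_mem' := by
        intro a c ha hc
        simp only [Set.mem_ofPred_eq] at ha hc ⊢
        filter_upwards [ha, hc] with ξ h1 h2 h
        simp only [Pi.add_apply, add_mul, Finset.sum_add_distrib, h1 h, h2 h, add_zero]
      zero_mem' := by simp
      smul_mem' := by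
        intro c a ha
        simp only [Set.mem_ofPred_eq] at ha ⊢
        filter_upwards [ha] with ξ h1 h
        simp only [Pi.smul_apply, smul_eq_mul, mul_assoc, ← Finset.mul_sum, h1 h, mul_zero] }
  have hV : ∀ m v, v ∈ V m ↔
      ∀ᵐ ξ : EuclideanSpace ℝ (Fin n), ‖ξ‖ ≤ m → ∑ j, v j * F j ξ = 0 := fun m v => Iff.rfl
  have hanti : Antitone V := by
    intro k m hkm v hv
    rw [hV] at hv ⊢
    filter_upwards [hv] with ξ h1 h
    exact h1 (h.trans (by exact_mod_cast hkm))
  obtain ⟨m, hm⟩ := IsArtinian.monotone_stabilizes (R := ℂ) (M := Fin N → ℂ)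
    ⟨fun k => OrderDual.toDual (V k), fun _ _ h => hanti h⟩
  have hm' : ∀ k, m ≤ k → V m = V k := fun k hk => hm k hk
  have hbot : ∀ v ∈ V m, v = 0 := by
    intro v hv
    apply hind
    have : ∀ k : ℕ, ∀ᵐ ξ : EuclideanSpace ℝ (Fin n), ‖ξ‖ ≤ k → ∑ j, v j * F j ξ = 0 := by
      intro k
      rw [← hV]
      rcases le_total m k with h | h
      · rw [← hm' k h]; exact hv
      · exact hanti h hv
    filter_upwards [ae_all_iff.2 this] with ξ h
    obtain ⟨k, hk⟩ := exists_nat_ge ‖ξ‖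
    exact h k hk
  intro j
  refine ⟨Metric.closedBall 0 (m + r), isCompact_closedBall _ _, ?_⟩
  filter_upwards [hp] with η h hη
  have h0 : (fun j => X j η) = 0 := by
    apply hbot
    rw [hV]
    filter_upwards [h] with ξ h1 h2
    apply h1
    simp only [Metric.mem_closedBall, dist_zero_right, not_le] at hη
    have := norm_sub_norm_le η ξ
    linarith
  exact congrFun h0 j

lemma fub_aux {n N : ℕ} (r : ℝ) (b : Fin N → ℂ)
    (χ φ : Fin N → (EuclideanSpace ℝ (Fin n) → ℂ))
    (hχ : ∀ j, Measurable (χ j)) (hφ : ∀ j, Measurable (φ j))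
    (hK : ∀ y : EuclideanSpace ℝ (Fin n), r ≤ ‖y‖ →
      ∀ᵐ ξ : EuclideanSpace ℝ (Fin n) ∂volume,
        (∑ j, b j * χ j (ξ + y) * (starRingEnd ℂ) (φ j ξ)) = 0) :
    (∀ᵐ ξ : EuclideanSpace ℝ (Fin n), ∀ᵐ η : EuclideanSpace ℝ (Fin n),
      r ≤ ‖η - ξ‖ → (∑ j, b j * χ j η * (starRingEnd ℂ) (φ j ξ)) = 0) ∧
    (∀ᵐ η : EuclideanSpace ℝ (Fin n), ∀ᵐ ξ : EuclideanSpace ℝ (Fin n),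
      r ≤ ‖η - ξ‖ → (∑ j, b j * χ j η * (starRingEnd ℂ) (φ j ξ)) = 0) := by
  have hc : Measurable (starRingEnd ℂ) := Complex.continuous_conj.measurable
  have h1 : ∀ᵐ y : EuclideanSpace ℝ (Fin n), ∀ᵐ ξ : EuclideanSpace ℝ (Fin n),
      r ≤ ‖y‖ → (∑ j, b j * χ j (ξ + y) * (starRingEnd ℂ) (φ j ξ)) = 0 := by
    refine Filter.Eventually.of_forall fun y => ?_
    by_cases hy : r ≤ ‖y‖
    · filter_upwards [hK y hy] with ξ h _ using h
    · exact Filter.Eventually.of_forall fun ξ h => absurd h hy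
  rw [Measure.ae_ae_comm] at h1
  swap
  · apply MeasurableSet.imp
    · exact measurableSet_le measurable_const (by fun_prop)
    · exact measurableSet_eq_fun (by fun_prop) measurable_const
  have h2 : ∀ᵐ ξ : EuclideanSpace ℝ (Fin n), ∀ᵐ η : EuclideanSpace ℝ (Fin n),
      r ≤ ‖η - ξ‖ → (∑ j, b j * χ j η * (starRingEnd ℂ) (φ j ξ)) = 0 := by
    filter_upwards [h1] with ξ h
    have := (measurePreserving_sub_right (volume : Measure (EuclideanSpace ℝ (Fin n)))
      ξ).quasiMeasurePreserving.ae h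
    filter_upwards [this] with η h3
    simpa using h3
  refine ⟨h2, ?_⟩
  rw [Measure.ae_ae_comm] at h2
  · exact h2
  · apply MeasurableSet.imp
    · exact measurableSet_le measurable_const (by fun_prop)
    · exact measurableSet_eq_fun (by fun_prop) measurable_const

lemma ind_aux {n N : ℕ} (χ : Fin N → (EuclideanSpace ℝ (Fin n) → ℂ))
    (hL : ∀ j, MemLp (χ j) 2 (volume : Measure (EuclideanSpace ℝ (Fin n))))
    (hi : LinearIndependent ℂ (fun j => MemLp.toLp (χ j) (hL j)))
    (v : Fin N → ℂ) (hv : ∀ᵐ ξ : EuclideanSpace ℝ (Fin n), ∑ j, v j * χ j ξ = 0) :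
    ∀ j, v j = 0 := by
  refine Fintype.linearIndependent_iff.1 hi v ?_
  have h : ∀ s : Finset (Fin N), (((∑ j ∈ s, v j • MemLp.toLp (χ j) (hL j) :
      Lp ℂ 2 (volume : Measure (EuclideanSpace ℝ (Fin n)))) :
      EuclideanSpace ℝ (Fin n) → ℂ)) =ᵐ[volume] fun ξ => ∑ j ∈ s, v j * χ j ξ := by
    intro s
    induction s using Finset.induction_on with
    | empty =>
      simp only [Finset.sum_empty]
      exact Lp.coeFn_zero _ _ _
    | insert a s ha ih =>
      rw [Finset.sum_insert ha]
      filter_upwards [ih, Lp.coeFn_add (v a • MemLp.toLp (χ a) (hL a))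
        (∑ j ∈ s, v j • MemLp.toLp (χ j) (hL j)),
        Lp.coeFn_smul (v a) (MemLp.toLp (χ a) (hL a)), (hL a).coeFn_toLp] with ξ h1 h2 h3 h4
      rw [h2, Finset.sum_insert ha, Pi.add_apply, h1, h3, Pi.smul_apply, h4, smul_eq_mul]
  rw [Lp.eq_zero_iff_ae_eq_zero]
  filter_upwards [h Finset.univ, hv] with ξ h1 h2
  rw [h1, h2]; rfl

/-- Let r > 0, b_1,…,b_N ∈ ℂ∖{0}, and χ_1,…,χ_N, φ_1,…,φ_N ∈ L²(ℝⁿ)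
with {χ_j} linearly independent and {φ_j} linearly independent (as elements of L²).
Define K_y(ξ) = ∑_j b_j χ_j(ξ + y) conj(φ_j(ξ)). If for every y with |y| ≥ r one has
K_y(ξ) = 0 for a.e. ξ, then each χ_j and each φ_j vanishes a.e. outside some compact set. -/
theorem stmt6 {n N : ℕ} (r : ℝ) (hr : 0 < r)
    (b : Fin N → ℂ) (hb : ∀ j, b j ≠ 0)
    (χ φ : Fin N → (EuclideanSpace ℝ (Fin n) → ℂ))
    (hχL2 : ∀ j, MemLp (χ j) 2 (volume : Measure (EuclideanSpace ℝ (Fin n))))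
    (hφL2 : ∀ j, MemLp (φ j) 2 (volume : Measure (EuclideanSpace ℝ (Fin n))))
    (hχind : LinearIndependent ℂ (fun j => MemLp.toLp (χ j) (hχL2 j)))
    (hφind : LinearIndependent ℂ (fun j => MemLp.toLp (φ j) (hφL2 j)))
    (hK : ∀ y : EuclideanSpace ℝ (Fin n), r ≤ ‖y‖ →
      ∀ᵐ ξ : EuclideanSpace ℝ (Fin n) ∂volume,
        (∑ j, b j * χ j (ξ + y) * (starRingEnd ℂ) (φ j ξ)) = 0) :
    (∀ j, ∃ C : Set (EuclideanSpace ℝ (Fin n)), IsCompact C ∧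
      ∀ᵐ ξ : EuclideanSpace ℝ (Fin n) ∂volume, ξ ∉ C → χ j ξ = 0) ∧
    (∀ j, ∃ C : Set (EuclideanSpace ℝ (Fin n)), IsCompact C ∧
      ∀ᵐ ξ : EuclideanSpace ℝ (Fin n) ∂volume, ξ ∉ C → φ j ξ = 0) := by
  have hχm : ∀ j, AEMeasurable (χ j) volume := fun j => (hχL2 j).1.aemeasurable
  have hφm : ∀ j, AEMeasurable (φ j) volume := fun j => (hφL2 j).1.aemeasurable
  have eχ : ∀ᵐ ξ : EuclideanSpace ℝ (Fin n), ∀ j, χ j ξ = (hχm j).mk (χ j) ξ :=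
    ae_all_iff.2 fun j => (hχm j).ae_eq_mk
  have eφ : ∀ᵐ ξ : EuclideanSpace ℝ (Fin n), ∀ j, φ j ξ = (hφm j).mk (φ j) ξ :=
    ae_all_iff.2 fun j => (hφm j).ae_eq_mk
  obtain ⟨h1, h2⟩ := fub_aux r b (fun j => (hχm j).mk (χ j)) (fun j => (hφm j).mk (φ j))
    (fun j => (hχm j).measurable_mk) (fun j => (hφm j).measurable_mk) (by
      intro y hy
      have := (measurePreserving_add_right (volume : Measure (EuclideanSpace ℝ (Fin n)))
        y).quasiMeasurePreserving.ae eχ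
      filter_upwards [hK y hy, this, eφ] with ξ h3 h4 h5
      rw [← h3]
      refine Finset.sum_congr rfl fun j _ => ?_
      rw [h4 j, h5 j])
  constructor
  · refine key_aux r (fun j ξ => b j * (starRingEnd ℂ) (φ j ξ)) χ ?_ ?_
    · intro v hv
      have := ind_aux φ hφL2 hφind (fun j => (starRingEnd ℂ) (v j * b j)) (by
        filter_upwards [hv] with ξ h
        have h' := congrArg (starRingEnd ℂ) h
        simpa [map_sum, mul_assoc] using h')
      funext j
      simpa [hb j] using this j
    · filter_upwards [h2, eχ] with η h3 h4
      filter_upwards [h3, eφ] with ξ h5 h6 h7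
      rw [← h5 h7]
      refine Finset.sum_congr rfl fun j _ => ?_
      rw [← h4 j, ← h6 j]; ring
  · have := key_aux r (fun j ξ => b j * χ j ξ) (fun j ξ => (starRingEnd ℂ) (φ j ξ)) ?_ ?_
    · simpa using this
    · intro v hv
      have := ind_aux χ hχL2 hχind (fun j => v j * b j) (by
        filter_upwards [hv] with ξ h
        simpa [mul_assoc] using h)
      funext j
      simpa [hb j] using this j
    · filter_upwards [h1, eφ] with ξ h3 h4
      filter_upwards [h3, eχ] with η h5 h6 h7
      rw [← h5 (by rwa [norm_sub_rev])]
      refine Finset.sum_congr rfl fun j _ => ?_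
      rw [← h4 j, ← h6 j]; ring
end
end

section
/- Let r > 0 and h_1, …, h_N ∈ L²(ℝⁿ). Define, for y ∈ ℝⁿ, K_y(ξ) = ∑_{j=1}^N h_j(ξ + y) conj(h_j(ξ)). If for every y ∈ ℝⁿ with |y| ≥ r one has K_y(ξ) = 0 for almost every ξ ∈ ℝⁿ, then each h_j vanishes almost everywhere outside some compact subset of ℝⁿ. -/
open MeasureTheory Complex

noncomputable section

/-- Let r > 0 and h_1, …, h_N ∈ L²(ℝⁿ). Define, for y ∈ ℝⁿ,
K_y(ξ) = ∑_{j=1}^N h_j(ξ + y) conj(h_j(ξ)). If for every y with |y| ≥ r one has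
K_y(ξ) = 0 for a.e. ξ, then each h_j vanishes a.e. outside some compact set. -/
theorem stmt9 {n N : ℕ} (r : ℝ) (hr : 0 < r)
    (h : Fin N → (EuclideanSpace ℝ (Fin n) → ℂ))
    (hL2 : ∀ j, MemLp (h j) 2 (volume : Measure (EuclideanSpace ℝ (Fin n))))
    (hK : ∀ y : EuclideanSpace ℝ (Fin n), r ≤ ‖y‖ →
      ∀ᵐ ξ : EuclideanSpace ℝ (Fin n) ∂volume,
        (∑ j, h j (ξ + y) * (starRingEnd ℂ) (h j ξ)) = 0) :
    ∀ j, ∃ C : Set (EuclideanSpace ℝ (Fin n)), IsCompact C ∧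
      ∀ᵐ ξ : EuclideanSpace ℝ (Fin n) ∂volume, ξ ∉ C → h j ξ = 0 := by
  have hg : ∃ g : Fin N → (EuclideanSpace ℝ (Fin n) → ℂ), (∀ j, Measurable (g j)) ∧
      ∀ j, h j =ᵐ[volume] g j := by
    choose g hg using fun j => (hL2 j).1
    exact ⟨g, fun j => (hg j).1.measurable, fun j => (hg j).2⟩
  obtain ⟨g, gm, hgj⟩ := hg
  have hge : ∀ᵐ ξ : EuclideanSpace ℝ (Fin n) ∂volume, ∀ j, h j ξ = g j ξ :=
    ae_all_iff.2 hgj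
  have hKg : ∀ y : EuclideanSpace ℝ (Fin n),
      ∀ᵐ ξ : EuclideanSpace ℝ (Fin n) ∂volume, r ≤ ‖y‖ →
        (∑ j, g j (ξ + y) * (starRingEnd ℂ) (g j ξ)) = 0 := by
    intro y
    by_cases hy : r ≤ ‖y‖
    · have h2 := (measurePreserving_add_right
        (volume : Measure (EuclideanSpace ℝ (Fin n))) y).quasiMeasurePreserving.ae hge
      filter_upwards [hK y hy, hge, h2] with ξ h0 h1 h2 _
      simpa only [h1, h2] using h0
    · exact Filter.Eventually.of_forall fun _ h' => absurd h' hy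
  have hmeas : MeasurableSet {p : EuclideanSpace ℝ (Fin n) × EuclideanSpace ℝ (Fin n) |
      r ≤ ‖p.1‖ → (∑ j, g j (p.2 + p.1) * (starRingEnd ℂ) (g j p.2)) = 0} := by
    have hA : MeasurableSet {p : EuclideanSpace ℝ (Fin n) × EuclideanSpace ℝ (Fin n) |
      r ≤ ‖p.1‖} := measurableSet_le measurable_const (by fun_prop)
    have hB : MeasurableSet {p : EuclideanSpace ℝ (Fin n) × EuclideanSpace ℝ (Fin n) |
      (∑ j, g j (p.2 + p.1) * (starRingEnd ℂ) (g j p.2)) = 0} := by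
      refine measurableSet_eq_fun ?_ measurable_const
      refine Finset.measurable_sum _ fun j _ => ?_
      exact ((gm j).comp (measurable_snd.add measurable_fst)).mul
        (Complex.continuous_conj.measurable.comp ((gm j).comp measurable_snd))
    exact hA.imp hB
  have hG0 := (Measure.ae_ae_comm (μ := (volume : Measure (EuclideanSpace ℝ (Fin n))))
    (ν := (volume : Measure (EuclideanSpace ℝ (Fin n)))) hmeas).1
    (Filter.Eventually.of_forall hKg)
  have hG : ∀ᵐ ξ : EuclideanSpace ℝ (Fin n) ∂volume,
      ∀ᵐ η : EuclideanSpace ℝ (Fin n) ∂volume, r ≤ ‖η - ξ‖ →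
        (∑ j, g j η * (starRingEnd ℂ) (g j ξ)) = 0 := by
    filter_upwards [hG0] with ξ hξ
    have := (measurePreserving_sub_right
        (volume : Measure (EuclideanSpace ℝ (Fin n))) ξ).quasiMeasurePreserving.ae hξ
    filter_upwards [this] with η hη
    simpa using hη
  by_contra hcon
  push Not at hcon
  obtain ⟨j0, hj0⟩ := hcon
  let V : EuclideanSpace ℝ (Fin n) → EuclideanSpace ℂ (Fin N) := fun ξ =>
    WithLp.toLp 2 fun j => g j ξ
  have hin : ∀ ξ η, inner ℂ (V ξ) (V η) = ∑ j, g j η * (starRingEnd ℂ) (g j ξ) := by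
    intro ξ η
    simp [V, PiLp.inner_apply]
  obtain ⟨f, hf1, hf2⟩ := exists_seq_of_forall_finset_exists
    (fun ξ => (∀ᵐ η : EuclideanSpace ℝ (Fin n) ∂volume, r ≤ ‖η - ξ‖ →
        inner ℂ (V ξ) (V η) = 0) ∧ V ξ ≠ 0)
    (fun ξ η => inner ℂ (V ξ) (V η) = 0) (by
      intro s hs
      obtain ⟨R, hR⟩ := s.finite_toSet.isBounded.subset_closedBall 0
      have hfreq := hj0 (Metric.closedBall 0 (R + r)) (isCompact_closedBall _ _)
      have hall : ∀ᵐ η : EuclideanSpace ℝ (Fin n) ∂volume, ∀ ξ ∈ s, r ≤ ‖η - ξ‖ →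
          inner ℂ (V ξ) (V η) = 0 :=
        (Finset.eventually_all s).2 fun ξ hξ => (hs ξ hξ).1
      obtain ⟨η, ⟨hη1, hη2⟩, h3, h4, h5⟩ :=
        (hfreq.and_eventually (hall.and (hge.and hG))).exists
      refine ⟨η, ⟨by simpa only [hin] using h5, ?_⟩, ?_⟩
      · intro h0
        apply hη2
        rw [h4]
        exact congrArg (fun v : EuclideanSpace ℂ (Fin N) => v j0) h0
      · intro ξ hξ
        apply h3 ξ hξ
        have h6 : ‖ξ‖ ≤ R := by simpa using hR hξ
        have h7 : R + r < ‖η‖ := by simpa using hη1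
        have := norm_sub_norm_le η ξ
        linarith)
  have hli : LinearIndependent ℂ (fun k => V (f k)) := by
    refine linearIndependent_of_ne_zero_of_inner_eq_zero (fun k => (hf1 k).2) ?_
    intro a b hab
    rcases lt_or_gt_of_ne hab with h' | h'
    · exact hf2 a b h'
    · exact inner_eq_zero_symm.1 (hf2 b a h')
  have := hli.finite
  exact not_finite ℕ
end
end
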